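/- For every positive integer k there exist a finite simple graph G and an initial configuration C_0 on G such that the 1/2-power index process started from C_0 is eventually periodic with period at least k. -/

import Mathlib

open scoped Classical

/-- A strategy of a voter: collaborator (`C`) or defector (`D`). -/
inductive Strategy : Type
  | C : Strategy
  | D : Strategy
deriving DecidableEq

noncomputable section

variable {V : Type*}

/-- The closed neighbourhood `N[v]` of a vertex, as a finset. -/
def closedNbhd (G : SimpleGraph V) [Fintype V] (v : V) : Finset V :=
  Finset.univ.filter fun u => u = v ∨ G.Adj u v

/-- The (Shapley–Shubik style) power of a vertex `v` in configuration `c`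
with win condition `w`. -/
def power (G : SimpleGraph V) [Fintype V] (w : ℝ) (c : V → Strategy) (v : V) : ℝ :=
  let N := closedNbhd G v
  let nC := (N.filter fun u => c u = Strategy.C).card
  let nD := (N.filter fun u => c u = Strategy.D).card
  match c v with
  | Strategy.C => if w < (nC : ℝ) / (N.card : ℝ) then 1 / (nC : ℝ) else 0
  | Strategy.D => if (nC : ℝ) / (N.card : ℝ) ≤ w then 1 / (nD : ℝ) else 0

/-- One step of the `w`-power index process: every vertex adopts the strategy of a
vertex of maximum power in its closed neighbourhood, retaining its own strategy if
vertices of maximum power have differing strategies. -/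
def step (G : SimpleGraph V) [Fintype V] (w : ℝ) (c : V → Strategy) (v : V) : Strategy :=
  let N := closedNbhd G v
  let M := N.filter fun u => ∀ x ∈ N, power G w c x ≤ power G w c u
  if ∀ u ∈ M, c u = Strategy.C then Strategy.C
  else if ∀ u ∈ M, c u = Strategy.D then Strategy.D
  else c v

/-- `configSeq G w c0 i` is the configuration `C_i` of the `w`-power index process. -/
def configSeq (G : SimpleGraph V) [Fintype V] (w : ℝ) (c0 : V → Strategy) : ℕ → V → Strategy
  | 0 => c0
  | k + 1 => step G w (configSeq G w c0 k)

/-- The process is eventually stable. -/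
def EventuallyStable (G : SimpleGraph V) [Fintype V] (w : ℝ) (c0 : V → Strategy) : Prop :=
  ∃ i, configSeq G w c0 (i + 1) = configSeq G w c0 i

/-- The process reaches a stable all-collaborator configuration. -/
def CollaboratorDominant (G : SimpleGraph V) [Fintype V] (w : ℝ) (c0 : V → Strategy) : Prop :=
  ∃ i, configSeq G w c0 (i + 1) = configSeq G w c0 i ∧
    ∀ v, configSeq G w c0 i v = Strategy.C

/-- The process reaches a stable all-defector configuration. -/
def DefectorDominant (G : SimpleGraph V) [Fintype V] (w : ℝ) (c0 : V → Strategy) : Prop :=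
  ∃ i, configSeq G w c0 (i + 1) = configSeq G w c0 i ∧
    ∀ v, configSeq G w c0 i v = Strategy.D

/-- The process is eventually periodic with period `ℓ`: `ℓ > 1` is the least integer
such that `C_i = C_{i+ℓ}` for some `i ≥ 0`. -/
def EventuallyPeriodicWithPeriod (G : SimpleGraph V) [Fintype V] (w : ℝ)
    (c0 : V → Strategy) (ℓ : ℕ) : Prop :=
  IsLeast {m : ℕ | 1 < m ∧ ∃ i, configSeq G w c0 (i + m) = configSeq G w c0 i} ℓ

end

section Transport

variable {V W : Type*} [Fintype V] [Fintype W]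

theorem closedNbhd_transport (G : SimpleGraph V) (e : V ≃ W) (v : V) :
    closedNbhd (G.comap e.symm) (e v) = (closedNbhd G v).map e.toEmbedding := by
  ext u
  simp only [closedNbhd, Finset.mem_filter, Finset.mem_univ, true_and, SimpleGraph.comap_adj,
    Finset.mem_map_equiv, Equiv.symm_apply_apply, Equiv.symm_apply_eq]

theorem power_transport (G : SimpleGraph V) (e : V ≃ W) (w : ℝ) (c : V → Strategy) (v : V) :
    power (G.comap e.symm) w (fun x => c (e.symm x)) (e v) = power G w c v := by
  simp only [power, closedNbhd_transport, Finset.filter_map, Finset.card_map,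
    Equiv.symm_apply_apply, Function.comp_def, Equiv.coe_toEmbedding]

theorem step_transport (G : SimpleGraph V) (e : V ≃ W) (w : ℝ) (c : V → Strategy) :
    step (G.comap e.symm) w (fun x => c (e.symm x)) = fun x => step G w c (e.symm x) := by
  funext x
  obtain ⟨v, rfl⟩ := e.surjective x
  simp only [step, closedNbhd_transport, Finset.mem_filter, Finset.mem_map, Equiv.symm_apply_apply,
    Equiv.coe_toEmbedding, and_imp, forall_exists_index, forall_apply_eq_imp_iff₂,
    power_transport]

theorem configSeq_transport (G : SimpleGraph V) (e : V ≃ W) (w : ℝ) (c : V → Strategy) (i : ℕ) :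
    configSeq (G.comap e.symm) w (fun x => c (e.symm x)) i
      = fun x => configSeq G w c i (e.symm x) := by
  induction i with
  | zero => rfl
  | succ i ih => simp only [configSeq, ih, step_transport]

end Transport

section StepLemmas

variable {V : Type*} [Fintype V]

theorem step_eq_C (G : SimpleGraph V) (w : ℝ) (c : V → Strategy) (v u : V)
    (hu : u ∈ closedNbhd G v) (_ : c u = Strategy.C)
    (h : ∀ x ∈ closedNbhd G v, c x = Strategy.D → power G w c x < power G w c u) :
    step G w c v = Strategy.C := by
  unfold step
  simp only
  rw [if_pos]
  intro z hz
  rw [Finset.mem_filter] at hz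
  cases hcz : c z with
  | C => rfl
  | D => exact absurd (h z hz.1 hcz) (not_lt.mpr (hz.2 u hu))

theorem step_eq_D (G : SimpleGraph V) (w : ℝ) (c : V → Strategy) (v u : V)
    (hu : u ∈ closedNbhd G v) (_ : c u = Strategy.D)
    (h : ∀ x ∈ closedNbhd G v, c x = Strategy.C → power G w c x < power G w c u) :
    step G w c v = Strategy.D := by
  have hall : ∀ z ∈ (closedNbhd G v).filter
      (fun u => ∀ x ∈ closedNbhd G v, power G w c x ≤ power G w c u), c z = Strategy.D := by
    intro z hz
    rw [Finset.mem_filter] at hz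
    cases hcz : c z with
    | D => rfl
    | C => exact absurd (h z hz.1 hcz) (not_lt.mpr (hz.2 u hu))
  obtain ⟨z, hz, hmax⟩ := Finset.exists_max_image (closedNbhd G v) (power G w c) ⟨u, hu⟩
  have hzM : z ∈ (closedNbhd G v).filter
      (fun u => ∀ x ∈ closedNbhd G v, power G w c x ≤ power G w c u) :=
    Finset.mem_filter.mpr ⟨hz, hmax⟩
  unfold step
  simp only
  rw [if_neg, if_pos hall]
  intro hC
  have h1 := hC z hzM
  rw [hall z hzM] at h1
  exact absurd h1 (by decide)

end StepLemmas

/-- The torus `C_n □ K_3` with `n = N + 10`. -/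
def torus (N : ℕ) : SimpleGraph (ZMod (N + 10) × Fin 3) where
  Adj u v := (u.1 = v.1 ∧ u.2 ≠ v.2) ∨ (u.2 = v.2 ∧ (u.1 = v.1 + 1 ∨ v.1 = u.1 + 1))
  symm := ⟨by
    rintro u v (⟨h1, h2⟩ | ⟨h1, h2⟩)
    · exact Or.inl ⟨h1.symm, h2.symm⟩
    · exact Or.inr ⟨h1.symm, h2.symm⟩⟩
  loopless := ⟨by
    rintro u (⟨_, h2⟩ | ⟨_, h2⟩)
    · exact h2 rfl
    · have : Fact (1 < N + 10) := ⟨by omega⟩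
      simp at h2⟩

/-- The travelling pattern. -/
def pat (a : ℕ) (y : Fin 3) : Strategy :=
  if a = 2 then (if y = 1 then Strategy.C else Strategy.D)
  else if a = 3 ∨ a = 4 then Strategy.C
  else if a = 5 then (if y = 1 then Strategy.D else Strategy.C)
  else Strategy.D

/-- The powers of the travelling pattern. -/
noncomputable def patPow (a : ℕ) (y : Fin 3) : ℝ :=
  if a = 1 then (if y = 1 then 1 / 4 else 1 / 5)
  else if a = 2 then (if y = 1 then 0 else 1 / 3)
  else if a = 3 then (if y = 1 then 1 / 5 else 1 / 4)
  else if a = 4 then (if y = 1 then 1 / 4 else 1 / 5)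
  else if a = 5 then (if y = 1 then 0 else 1 / 3)
  else if a = 6 then (if y = 1 then 1 / 5 else 1 / 4)
  else 1 / 5

/-- The configuration at time `s`. -/
def cfg (N : ℕ) (s : ZMod (N + 10)) (v : ZMod (N + 10) × Fin 3) : Strategy :=
  pat (v.1 - s).val v.2

theorem zmod_val_succ (N : ℕ) (x : ZMod (N + 10)) :
    (x + 1).val = x.val + 1 ∨ (x.val + 1 = N + 10 ∧ (x + 1).val = 0) := by
  have h1 : (1 : ZMod (N + 10)).val = 1 := by
    have : Fact (1 < N + 10) := ⟨by omega⟩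
    exact ZMod.val_one _
  have hlt := ZMod.val_lt x
  rw [ZMod.val_add, h1]
  rcases Nat.lt_or_ge (x.val + 1) (N + 10) with h | h
  · left; exact Nat.mod_eq_of_lt h
  · right
    have : x.val + 1 = N + 10 := by omega
    exact ⟨this, by rw [this, Nat.mod_self]⟩

theorem succ_ne (N : ℕ) (x : ZMod (N + 10)) : x + 1 ≠ x := by
  have : Fact (1 < N + 10) := ⟨by omega⟩
  simp

theorem closedNbhd_torus (N : ℕ) (x : ZMod (N + 10)) (y : Fin 3) :
    closedNbhd (torus N) (x, y) = {(x, 0), (x, 1), (x, 2), (x + 1, y), (x - 1, y)} := by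
  ext ⟨a, b⟩
  simp only [closedNbhd, Finset.mem_filter, Finset.mem_univ, true_and, Finset.mem_insert,
    Finset.mem_singleton, Prod.mk.injEq]
  simp only [torus]
  have h : x = a + 1 ↔ a = x - 1 := by
    constructor <;> rintro rfl <;> ring
  rw [h]
  by_cases hax : a = x
  · subst hax
    fin_cases b <;> fin_cases y <;> simp
  · simp only [hax, false_and, false_or]
    tauto

theorem sum_closedNbhd_torus (N : ℕ) (x : ZMod (N + 10)) (y : Fin 3)
    (f : ZMod (N + 10) × Fin 3 → ℕ) :
    ∑ u ∈ closedNbhd (torus N) (x, y), f u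
      = f (x, 0) + (f (x, 1) + (f (x, 2) + (f (x + 1, y) + f (x - 1, y)))) := by
  have h1 : x + 1 ≠ x := succ_ne N x
  have h2 : x - 1 ≠ x := by
    intro h
    have := succ_ne N (x - 1)
    rw [sub_add_cancel] at this
    exact this h.symm
  have h3 : x + 1 ≠ x - 1 := by
    intro h
    have e1 := zmod_val_succ N (x - 1)
    have e2 := zmod_val_succ N x
    rw [sub_add_cancel] at e1
    rw [h] at e2
    omega
  rw [closedNbhd_torus]
  rw [Finset.sum_insert, Finset.sum_insert, Finset.sum_insert, Finset.sum_insert,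
    Finset.sum_singleton]
  all_goals simp [h1.symm, h2.symm, h3]

theorem card_filter_torus (N : ℕ) (x : ZMod (N + 10)) (y : Fin 3)
    (c : ZMod (N + 10) × Fin 3 → Strategy) (t : Strategy) :
    ((closedNbhd (torus N) (x, y)).filter fun u => c u = t).card
      = (if c (x, 0) = t then 1 else 0) + ((if c (x, 1) = t then 1 else 0) +
        ((if c (x, 2) = t then 1 else 0) + ((if c (x + 1, y) = t then 1 else 0) +
          (if c (x - 1, y) = t then 1 else 0)))) := by
  rw [Finset.card_filter, sum_closedNbhd_torus]

theorem cases_val (N a b d : ℕ) (ha : a < N + 10)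
    (hb : b = a + 1 ∨ (a + 1 = N + 10 ∧ b = 0))
    (hd : a = d + 1 ∨ (d + 1 = N + 10 ∧ a = 0)) :
    (a = 1 ∧ b = 2 ∧ d = 0) ∨ (a = 2 ∧ b = 3 ∧ d = 1) ∨ (a = 3 ∧ b = 4 ∧ d = 2) ∨
    (a = 4 ∧ b = 5 ∧ d = 3) ∨ (a = 5 ∧ b = 6 ∧ d = 4) ∨ (a = 6 ∧ b = 7 ∧ d = 5) ∨
    ((a = 0 ∨ 7 ≤ a) ∧ (b ≤ 1 ∨ 7 ≤ b) ∧ (d ≤ 1 ∨ 6 ≤ d)) := by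
  by_cases h0 : a = 0 ∨ 7 ≤ a
  · iterate 6 right
    refine ⟨h0, ?_, ?_⟩ <;> omega
  · have hb' : b = a + 1 := by omega
    have hd' : d = a - 1 := by omega
    subst hb' hd'
    have h1 : 1 ≤ a := by omega
    have h2 : a ≤ 6 := by omega
    clear hb hd h0 ha
    interval_cases a <;> simp

theorem pat_far (a : ℕ) (y : Fin 3) (h : a ≤ 1 ∨ 6 ≤ a) : pat a y = Strategy.D := by
  unfold pat
  rw [if_neg (by omega), if_neg (by omega), if_neg (by omega)]

theorem val_cases (N : ℕ) (s x : ZMod (N + 10)) :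
    ∃ a b d : ℕ, (x - s).val = a ∧ (x + 1 - s).val = b ∧ (x - 1 - s).val = d ∧
    ((a = 1 ∧ b = 2 ∧ d = 0) ∨ (a = 2 ∧ b = 3 ∧ d = 1) ∨ (a = 3 ∧ b = 4 ∧ d = 2) ∨
    (a = 4 ∧ b = 5 ∧ d = 3) ∨ (a = 5 ∧ b = 6 ∧ d = 4) ∨ (a = 6 ∧ b = 7 ∧ d = 5) ∨
    ((a = 0 ∨ 7 ≤ a) ∧ (b ≤ 1 ∨ 7 ≤ b) ∧ (d ≤ 1 ∨ 6 ≤ d))) := by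
  refine ⟨_, _, _, rfl, rfl, rfl, cases_val N _ _ _ (ZMod.val_lt _) ?_ ?_⟩
  · have := zmod_val_succ N (x - s)
    rwa [show x - s + 1 = x + 1 - s by ring] at this
  · have := zmod_val_succ N (x - 1 - s)
    rwa [show x - 1 - s + 1 = x - s by ring] at this

theorem power_cfg (N : ℕ) (s x : ZMod (N + 10)) (y : Fin 3) :
    power (torus N) (1 / 2) (cfg N s) (x, y) = patPow (x - s).val y := by
  have hcard : (closedNbhd (torus N) (x, y)).card = 5 := by
    rw [Finset.card_eq_sum_ones, sum_closedNbhd_torus]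
  obtain ⟨a, b, d, ha, hb, hd, h⟩ := val_cases N s x
  have hC := card_filter_torus N x y (cfg N s) Strategy.C
  have hD := card_filter_torus N x y (cfg N s) Strategy.D
  unfold power
  simp only [hcard]
  rw [hC, hD]
  simp only [cfg, ha, hb, hd]
  clear hC hD hcard ha hb hd
  rcases h with h | h | h | h | h | h | ⟨h1, h2, h3⟩
  iterate 6
    · obtain ⟨rfl, rfl, rfl⟩ := h
      fin_cases y <;> simp [pat, patPow] <;> norm_num
  · rw [pat_far a 0 (by omega), pat_far a 1 (by omega), pat_far a 2 (by omega),
      pat_far a y (by omega), pat_far b y (by omega), pat_far d y (by omega)]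
    have hP : patPow a y = 1 / 5 := by
      unfold patPow
      rw [if_neg (by omega), if_neg (by omega), if_neg (by omega), if_neg (by omega),
        if_neg (by omega), if_neg (by omega)]
    rw [hP]
    have hDC : ¬ (Strategy.D = Strategy.C) := by decide
    simp only [hDC, if_false, if_true]
    norm_num

theorem step_cfg (N : ℕ) (s : ZMod (N + 10)) :
    step (torus N) (1 / 2) (cfg N s) = cfg N (s + 1) := by
  funext ⟨x, y⟩
  obtain ⟨a, b, d, ha, hb, hd, h⟩ := val_cases N s x
  have hR : cfg N (s + 1) (x, y) = pat d y := by
    simp only [cfg]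
    rw [← hd, show x - (s + 1) = x - 1 - s by ring]
  rw [hR]
  -- reduction to a check on five vertices
  have key : ∀ u ∈ closedNbhd (torus N) (x, y),
      (cfg N s u ≠ pat d y → False) →
      (∀ z ∈ closedNbhd (torus N) (x, y), cfg N s z ≠ pat d y →
        power (torus N) (1 / 2) (cfg N s) z < power (torus N) (1 / 2) (cfg N s) u) →
      step (torus N) (1 / 2) (cfg N s) (x, y) = pat d y := by
    intro u hu h1 h2
    have h1' : cfg N s u = pat d y := by_contra h1
    cases hp : pat d y with
    | C =>
      rw [hp] at h1' h2
      exact step_eq_C _ _ _ _ u hu h1' (fun z hz hz' => h2 z hz (by rw [hz']; decide))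
    | D =>
      rw [hp] at h1' h2
      exact step_eq_D _ _ _ _ u hu h1' (fun z hz hz' => h2 z hz (by rw [hz']; decide))
  have key2 : ∀ u ∈ closedNbhd (torus N) (x, y), cfg N s u = pat d y →
      ((pat a 0 ≠ pat d y → patPow a 0 < patPow (u.1 - s).val u.2) ∧
       (pat a 1 ≠ pat d y → patPow a 1 < patPow (u.1 - s).val u.2) ∧
       (pat a 2 ≠ pat d y → patPow a 2 < patPow (u.1 - s).val u.2) ∧
       (pat b y ≠ pat d y → patPow b y < patPow (u.1 - s).val u.2) ∧
       (pat d y ≠ pat d y → patPow d y < patPow (u.1 - s).val u.2)) →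
      step (torus N) (1 / 2) (cfg N s) (x, y) = pat d y := by
    rintro ⟨u1, u2⟩ hu h1 ⟨h2, h3, h4, h5, h6⟩
    refine key (u1, u2) hu (fun h => h h1) ?_
    intro z hz
    rw [closedNbhd_torus] at hz
    simp only [Finset.mem_insert, Finset.mem_singleton] at hz
    rw [power_cfg N s u1 u2]
    rcases hz with rfl | rfl | rfl | rfl | rfl <;> rw [power_cfg] <;>
      simp only [cfg, ha, hb, hd] <;> assumption
  have m0 : (x, (0 : Fin 3)) ∈ closedNbhd (torus N) (x, y) := by simp [closedNbhd_torus]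
  have m1 : (x, (1 : Fin 3)) ∈ closedNbhd (torus N) (x, y) := by simp [closedNbhd_torus]
  have mb : (x + 1, y) ∈ closedNbhd (torus N) (x, y) := by simp [closedNbhd_torus]
  have md : (x - 1, y) ∈ closedNbhd (torus N) (x, y) := by simp [closedNbhd_torus]
  have k0 := key2 _ m0
  have k1 := key2 _ m1
  have kb := key2 _ mb
  have kd := key2 _ md
  simp only [cfg, ha, hb, hd] at k0 k1 kb kd
  rcases h with h | h | h | h | h | h | ⟨h1, h2, h3⟩
  iterate 6
    · obtain ⟨rfl, rfl, rfl⟩ := h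
      fin_cases y <;> simp [pat, patPow] at k0 k1 kb kd ⊢ <;> norm_num at k0 k1 kb kd ⊢ <;>
        assumption
  · apply k0
    · rw [pat_far a 0 (by omega), pat_far d y (by omega)]
    · rw [pat_far a 0 (by omega), pat_far a 1 (by omega), pat_far a 2 (by omega),
        pat_far b y (by omega), pat_far d y (by omega)]
      simp

theorem configSeq_cfg (N i : ℕ) :
    configSeq (torus N) (1 / 2) (cfg N 0) i = cfg N (i : ZMod (N + 10)) := by
  induction i with
  | zero => simp [configSeq]
  | succ i ih => rw [configSeq, ih, step_cfg]; push_cast; rfl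

theorem pat_unique (a : ℕ) (h0 : pat a 0 = Strategy.D) (h1 : pat a 1 = Strategy.C) : a = 2 := by
  unfold pat at h0 h1
  split_ifs at h0 h1 <;> simp_all

theorem cfg_inj (N : ℕ) (s t : ZMod (N + 10)) (h : cfg N s = cfg N t) : s = t := by
  have h2 : ((2 : ℕ) : ZMod (N + 10)).val = 2 := ZMod.val_cast_of_lt (by omega)
  have e : ∀ y, pat 2 y = pat (s + (2 : ℕ) - t).val y := by
    intro y
    have := congrFun h (s + (2 : ℕ), y)
    simp only [cfg] at this
    rwa [add_sub_cancel_left, h2] at this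
  have h3 := pat_unique _ ((e 0).symm.trans (by simp [pat])) ((e 1).symm.trans (by simp [pat]))
  have h4 : s + (2 : ℕ) - t = (2 : ℕ) := ZMod.val_injective _ (h3.trans h2.symm)
  linear_combination h4

/-- For every positive integer `k` there exist a finite simple
graph and an initial configuration from which the `1/2`-power index process is
eventually periodic with period at least `k`. -/
theorem statement13 (k : ℕ) (hk : 0 < k) :
    ∃ (m : ℕ) (G : SimpleGraph (Fin m)) (c0 : Fin m → Strategy) (ℓ : ℕ),
      k ≤ ℓ ∧ EventuallyPeriodicWithPeriod G (1 / 2) c0 ℓ := by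
  let e := Fintype.equivFin (ZMod (k + 10) × Fin 3)
  refine ⟨_, (torus k).comap e.symm, fun x => cfg k 0 (e.symm x), k + 10, by omega, ?_⟩
  refine ⟨⟨by omega, 0, ?_⟩, ?_⟩
  · rw [configSeq_transport, configSeq_transport, configSeq_cfg, configSeq_cfg, zero_add,
      ZMod.natCast_self, Nat.cast_zero]
  · rintro m ⟨hm, i, hi⟩
    rw [configSeq_transport, configSeq_transport, configSeq_cfg, configSeq_cfg] at hi
    have h1 : cfg k ((i + m : ℕ) : ZMod (k + 10)) = cfg k (i : ZMod (k + 10)) := by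
      funext v
      have := congrFun hi (e v)
      simpa using this
    have h2 := cfg_inj _ _ _ h1
    push_cast at h2
    have h3 : (m : ZMod (k + 10)) = 0 := by linear_combination h2
    rw [ZMod.natCast_eq_zero_iff] at h3
    exact Nat.le_of_dvd (by omega) h3
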